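/- The efficient influence function has mean zero under exchangeability: assume A ≤ R ℙ-almost surely; under ℙ₁ = ℙ(· ∣ R=1), A is conditionally independent of (Y(0), Y(1)) given σ(X); under ℙ, R is conditionally independent of Y(0) given σ(X); and there is δ ∈ (0, 1/2) with δ ≤ e₁(X) ≤ 1 − δ and π(X) ≥ δ ℙ-almost surely, where e₁(X) is a version of ℙ₁(A=1 ∣ σ(X)) and π(X) a version of ℙ(R=1 ∣ σ(X)). Let e_S(X) be a version of ℙ(A=1 ∣ σ(X)), mₐ(X) a version of 𝔼[Y ∣ X, A=a] under ℙ (a = 0, 1), and τ = 𝔼[Y(1) − Y(0) ∣ R=1]. Then 𝔼[ φ ] = 0, where φ = (π(X)/q)·[ R·A·(Y − m₁(X))/e_S(X) − (1−A)·(Y − m₀(X))/(1 − e_S(X)) ] + (R/q)·( m₁(X) − m₀(X) − τ ). -/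

import Mathlib

open MeasureTheory ProbabilityTheory

/-- Any conditional measure of a finite measure is a finite measure. -/
instance cond_isFiniteMeasure {Ω : Type*} [MeasurableSpace Ω] (μ : Measure Ω)
    [IsFiniteMeasure μ] (s : Set Ω) : IsFiniteMeasure (μ[|s]) := by
  constructor
  rw [ProbabilityTheory.cond, Measure.smul_apply, Measure.restrict_apply MeasurableSet.univ,
    Set.univ_inter, smul_eq_mul]
  exact lt_of_le_of_lt (ENNReal.inv_mul_le_one _) ENNReal.one_lt_top

/-- `v ∘ X` is a version of `𝔼_Q[W ∣ X]` on the event where the (real-valued) indicator `ind`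
equals one: for every bounded measurable `h : ℝ^p → ℝ`,
`𝔼_Q[ind · W · h(X)] = 𝔼_Q[ind · v(X) · h(X)]`.  Versions of conditional expectations
`𝔼_Q[Y ∣ X, A = a]` are obtained with `ind = 1{A=a}` and `W = Y`; versions of conditional
probabilities such as `Q(R=1 ∣ σ(X))` are obtained with `ind = 1` and `W = 1{R=1}`. -/
def IsCondVersion {Ω : Type*} [MeasurableSpace Ω] {p : ℕ} (Q : Measure Ω)
    (X : Ω → Fin p → ℝ) (ind : Ω → ℝ) (W : Ω → ℝ) (v : (Fin p → ℝ) → ℝ) : Prop :=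
  Measurable v ∧ ∀ h : (Fin p → ℝ) → ℝ, Measurable h → (∃ C, ∀ x, |h x| ≤ C) →
    ∫ ω, ind ω * W ω * h (X ω) ∂Q = ∫ ω, ind ω * v (X ω) * h (X ω) ∂Q


/-- Automatic integrability of a version. -/
lemma IsCondVersion.integrable_aux {Ω : Type*} [MeasurableSpace Ω] {p : ℕ} {Q : Measure Ω}
    [IsFiniteMeasure Q] {X : Ω → Fin p → ℝ} (hX : Measurable X) {ind W : Ω → ℝ}
    {v : (Fin p → ℝ) → ℝ} (hind : Measurable ind) (h01 : ∀ ω, ind ω = 0 ∨ ind ω = 1)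
    (hW : Integrable (fun ω => ind ω * W ω) Q)
    (hv : IsCondVersion Q X ind W v) : Integrable (fun ω => ind ω * v (X ω)) Q := by
  obtain ⟨hvm, hv⟩ := hv
  have hvX : Measurable (fun ω => v (X ω)) := hvm.comp hX
  refine ⟨(hind.mul hvX).aestronglyMeasurable, ?_⟩
  let h : ℕ → (Fin p → ℝ) → ℝ := fun n =>
    Set.indicator {x | |v x| ≤ n} (fun x => if 0 ≤ v x then 1 else -1)
  have hset : ∀ n : ℕ, MeasurableSet {x | |v x| ≤ (n : ℝ)} := fun n =>
    measurableSet_le (by fun_prop) measurable_const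
  have hhm : ∀ n, Measurable (h n) := fun n =>
    (Measurable.ite (measurableSet_le measurable_const hvm) measurable_const
      measurable_const).indicator (hset n)
  have hhb : ∀ n x, |h n x| ≤ 1 := by
    intro n x
    simp only [h, Set.indicator]
    split_ifs <;> simp
  have hprod : ∀ n ω, ind ω * v (X ω) * h n (X ω)
      = Set.indicator {x | |v x| ≤ n} (fun _ => |ind ω * v (X ω)|) (X ω) := by
    intro n ω
    simp only [h, Set.indicator]
    rcases h01 ω with h0 | h0 <;> rw [h0] <;> split_ifs with h1 h2 <;> simp
    · rw [abs_of_nonneg h2]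
    · rw [abs_of_neg (not_le.mp h2)]
  have hI : ∀ n, Integrable (fun ω => ind ω * v (X ω) * h n (X ω)) Q := by
    intro n
    refine Integrable.of_bound (C := n)
      ((hind.mul hvX).mul ((hhm n).comp hX)).aestronglyMeasurable (ae_of_all _ fun ω => ?_)
    rw [hprod]
    simp only [Set.indicator, Set.mem_ofPred_eq]
    split_ifs with h1
    · rcases h01 ω with h0 | h0 <;> rw [h0] <;> simp [h1]
    · simp
  have hbound : ∀ n, ∫⁻ ω, ENNReal.ofReal (ind ω * v (X ω) * h n (X ω)) ∂Q
      ≤ ENNReal.ofReal (∫ ω, |ind ω * W ω| ∂Q) := by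
    intro n
    rw [← ofReal_integral_eq_lintegral_ofReal (hI n)]
    · apply ENNReal.ofReal_le_ofReal
      rw [← hv (h n) (hhm n) ⟨1, hhb n⟩]
      have hIW : Integrable (fun ω => ind ω * W ω * h n (X ω)) Q :=
        hW.mul_bdd ((hhm n).comp hX).aestronglyMeasurable (ae_of_all _ fun ω => hhb n (X ω))
      refine integral_mono hIW hW.abs fun ω => ?_
      calc ind ω * W ω * h n (X ω) ≤ |ind ω * W ω * h n (X ω)| := le_abs_self _
        _ = |ind ω * W ω| * |h n (X ω)| := abs_mul _ _
        _ ≤ |ind ω * W ω| * 1 := mul_le_mul_of_nonneg_left (hhb n _) (abs_nonneg _)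
        _ = |ind ω * W ω| := mul_one _
    · refine ae_of_all _ fun ω => ?_
      simp only [hprod, Pi.zero_apply]
      exact Set.indicator_nonneg (fun _ _ => abs_nonneg _) _
  have hlim : Filter.Tendsto
      (fun n => ∫⁻ ω, ENNReal.ofReal (ind ω * v (X ω) * h n (X ω)) ∂Q) Filter.atTop
      (nhds (∫⁻ ω, ‖ind ω * v (X ω)‖ₑ ∂Q)) := by
    refine lintegral_tendsto_of_tendsto_of_monotone ?_ ?_ ?_
    · intro n
      exact (ENNReal.measurable_ofReal.comp
        ((hind.mul hvX).mul ((hhm n).comp hX))).aemeasurable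
    · refine ae_of_all _ fun ω n m hnm => ?_
      apply ENNReal.ofReal_le_ofReal
      rw [hprod, hprod]
      refine Set.indicator_le_indicator_of_subset ?_ (fun _ => abs_nonneg _) _
      intro x hx
      have hx1 : |v x| ≤ (n : ℝ) := hx
      have hx2 : (n : ℝ) ≤ (m : ℝ) := by exact_mod_cast hnm
      exact hx1.trans hx2
    · refine ae_of_all _ fun ω => ?_
      obtain ⟨N, hN⟩ := exists_nat_ge |v (X ω)|
      refine tendsto_const_nhds.congr' ?_
      filter_upwards [Filter.eventually_ge_atTop N] with n hn
      rw [hprod, Set.indicator_of_mem, ← Real.enorm_eq_ofReal_abs]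
      exact le_trans hN (by exact_mod_cast hn)
  exact lt_of_le_of_lt (le_of_tendsto' hlim hbound) ENNReal.ofReal_lt_top

/-- The version identity for a.s. bounded test functions. -/
lemma IsCondVersion.eq_of_ae_bdd {Ω : Type*} [MeasurableSpace Ω] {p : ℕ} {Q : Measure Ω}
    {X : Ω → Fin p → ℝ} {ind W : Ω → ℝ}
    {v : (Fin p → ℝ) → ℝ} (hv : IsCondVersion Q X ind W v)
    {h : (Fin p → ℝ) → ℝ} (hh : Measurable h) {C : ℝ} (hC : ∀ᵐ ω ∂Q, |h (X ω)| ≤ C) :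
    ∫ ω, ind ω * W ω * h (X ω) ∂Q = ∫ ω, ind ω * v (X ω) * h (X ω) ∂Q := by
  have hs : MeasurableSet {x | |h x| ≤ C} := measurableSet_le (by fun_prop) measurable_const
  have key := hv.2 (Set.indicator {x | |h x| ≤ C} h) (hh.indicator hs) ⟨|C|, fun x => by
    simp only [Set.indicator, Set.mem_ofPred_eq]
    split_ifs with h1
    · exact h1.trans (le_abs_self C)
    · simp⟩
  have e : ∀ᵐ ω ∂Q, Set.indicator {x | |h x| ≤ C} h (X ω) = h (X ω) := by
    filter_upwards [hC] with ω hω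
    exact Set.indicator_of_mem (s := {x | |h x| ≤ C}) hω h
  calc _ = _ := integral_congr_ae (by filter_upwards [e] with ω hω; rw [hω])
    _ = _ := key
    _ = _ := integral_congr_ae (by filter_upwards [e] with ω hω; rw [hω])

lemma IsCondVersion.ae_eq_condExp {Ω : Type*} [MeasurableSpace Ω] {p : ℕ} {Q : Measure Ω}
    [IsFiniteMeasure Q] {X : Ω → Fin p → ℝ} (hX : Measurable X) {W : Ω → ℝ}
    {w : (Fin p → ℝ) → ℝ} (hW : Integrable W Q)
    (hw : IsCondVersion Q X (fun _ => 1) W w) :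
    (fun ω => w (X ω)) =ᵐ[Q] Q[W | MeasurableSpace.comap X inferInstance] := by
  have hint : Integrable (fun ω => w (X ω)) Q := by
    simpa using hw.integrable_aux hX measurable_const (fun _ => Or.inr rfl) (by simpa using hW)
  refine ae_eq_condExp_of_forall_setIntegral_eq hX.comap_le hW
    (fun s _ _ => hint.integrableOn) ?_ ?_
  · rintro s ⟨t, ht, rfl⟩ -
    have := hw.2 (Set.indicator t (fun _ => 1)) (measurable_const.indicator ht)
      ⟨1, fun x => by simp only [Set.indicator]; split_ifs <;> simp⟩
    rw [← integral_indicator (hX ht), ← integral_indicator (hX ht)]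
    convert this.symm using 2 <;>
    · ext ω
      by_cases h : X ω ∈ t <;> simp [Set.indicator, h]
  · exact (hw.1.comp (comap_measurable X)).stronglyMeasurable.aestronglyMeasurable

lemma pull_out_aux {Ω : Type*} {m m0 : MeasurableSpace Ω} {Q : Measure Ω}
    [IsFiniteMeasure Q] (hm : m ≤ m0) {W w F : Ω → ℝ} (hW : Integrable W Q)
    (hw : w =ᵐ[Q] Q[W | m]) (hF : StronglyMeasurable[m] F)
    (hWF : Integrable (fun ω => W ω * F ω) Q) :
    Integrable (fun ω => w ω * F ω) Q ∧ ∫ ω, W ω * F ω ∂Q = ∫ ω, w ω * F ω ∂Q := by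
  have h1 : Q[fun ω => W ω * F ω | m] =ᵐ[Q] fun ω => w ω * F ω := by
    filter_upwards [condExp_mul_of_stronglyMeasurable_right hF hWF hW, hw] with ω h2 h3
    rw [h3]; exact h2
  refine ⟨integrable_condExp.congr h1, ?_⟩
  rw [← integral_condExp hm, integral_congr_ae h1]

lemma IsCondVersion.pull_out {Ω : Type*} [MeasurableSpace Ω] {p : ℕ} {Q : Measure Ω}
    [IsFiniteMeasure Q] {X : Ω → Fin p → ℝ} (hX : Measurable X) {W : Ω → ℝ}
    {w : (Fin p → ℝ) → ℝ} (hW : Integrable W Q)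
    (hw : IsCondVersion Q X (fun _ => 1) W w) {F : (Fin p → ℝ) → ℝ} (hF : Measurable F)
    (hWF : Integrable (fun ω => W ω * F (X ω)) Q) :
    Integrable (fun ω => w (X ω) * F (X ω)) Q ∧
      ∫ ω, W ω * F (X ω) ∂Q = ∫ ω, w (X ω) * F (X ω) ∂Q :=
  pull_out_aux hX.comap_le hW (hw.ae_eq_condExp hX hW)
    (F := fun ω => F (X ω)) (hF.comp (comap_measurable X)).stronglyMeasurable hWF

lemma IsCondVersion.pull_out_indep {Ω : Type*} [MeasurableSpace Ω] [StandardBorelSpace Ω]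
    {β : Type*} [MeasurableSpace β] [StandardBorelSpace β] [Nonempty β]
    {p : ℕ} {Q : Measure Ω}
    [IsFiniteMeasure Q] {X : Ω → Fin p → ℝ} (hX : Measurable X) {W : Ω → ℝ} (hWm : Measurable W)
    {V : Ω → β} (hV : Measurable V)
    {w : (Fin p → ℝ) → ℝ} (hW : Integrable W Q)
    (hw : IsCondVersion Q X (fun _ => 1) W w)
    (hI : CondIndepFun (MeasurableSpace.comap X inferInstance) hX.comap_le W V Q)
    {F : (Fin p → ℝ) × β → ℝ} (hF : Measurable F)
    (hWF : Integrable (fun ω => W ω * F (X ω, V ω)) Q) :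
    Integrable (fun ω => w (X ω) * F (X ω, V ω)) Q ∧
      ∫ ω, W ω * F (X ω, V ω) ∂Q = ∫ ω, w (X ω) * F (X ω, V ω) ∂Q := by
  have hXV : Measurable (fun ω => (X ω, V ω)) := hX.prodMk hV
  have h1 := (condIndepFun_iff_condDistrib_prod_ae_eq_prodMkRight hWm hV hX).1 hI.symm
  have h2 := ae_of_ae_map hXV.aemeasurable h1
  have h3 := condExp_ae_eq_integral_condDistrib' (μ := Q) hXV hW
  have h4 := condExp_ae_eq_integral_condDistrib' (μ := Q) hX hW
  refine pull_out_aux hXV.comap_le hW (w := fun ω => w (X ω)) ?_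
    (F := fun ω => F (X ω, V ω)) (hF.comp (comap_measurable _)).stronglyMeasurable hWF
  filter_upwards [h2, h3, h4, hw.ae_eq_condExp hX hW] with ω g2 g3 g4 g5
  rw [g5, g4, g3, g2]
  rfl

lemma IsCondVersion.one_sub {Ω : Type*} [MeasurableSpace Ω] {p : ℕ} {Q : Measure Ω}
    [IsFiniteMeasure Q] {X : Ω → Fin p → ℝ} (hX : Measurable X) {W : Ω → ℝ}
    {w : (Fin p → ℝ) → ℝ} (hW : Integrable W Q)
    (hw : IsCondVersion Q X (fun _ => 1) W w) :
    IsCondVersion Q X (fun _ => 1) (fun ω => 1 - W ω) (fun x => 1 - w x) := by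
  have hint : Integrable (fun ω => w (X ω)) Q := by
    simpa using hw.integrable_aux hX measurable_const (fun _ => Or.inr rfl) (by simpa using hW)
  refine ⟨measurable_const.sub hw.1, fun h hh ⟨C, hC⟩ => ?_⟩
  have key := hw.2 h hh ⟨C, hC⟩
  have hhX : AEStronglyMeasurable (fun ω => h (X ω)) Q := (hh.comp hX).aestronglyMeasurable
  have hb : ∀ᵐ ω ∂Q, ‖h (X ω)‖ ≤ C := ae_of_all _ fun ω => hC _
  have i0 : Integrable (fun ω => h (X ω)) Q := Integrable.of_bound hhX C hb
  have i1 := hW.mul_bdd hhX hb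
  have i2 := hint.mul_bdd hhX hb
  simp only [one_mul, sub_mul] at key ⊢
  rw [integral_sub i0 i1, integral_sub i0 i2, key]

/-- The efficient influence function `φ` has mean zero under exchangeability. -/
theorem eif_mean_zero {Ω : Type*} [MeasurableSpace Ω] [StandardBorelSpace Ω] [Nonempty Ω]
    (P : Measure Ω) [IsProbabilityMeasure P]
    (p : ℕ) (hp : 1 ≤ p)
    (X : Ω → Fin p → ℝ) (hX : Measurable X)
    (A R : Ω → ℝ) (hA : Measurable A) (hR : Measurable R)
    (hA01 : ∀ ω, A ω = 0 ∨ A ω = 1) (hR01 : ∀ ω, R ω = 0 ∨ R ω = 1)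
    -- external-control units are never treated
    (hAR : ∀ᵐ ω ∂P, A ω ≤ R ω)
    (Y0 Y1 : Ω → ℝ) (hY0m : Measurable Y0) (hY1m : Measurable Y1)
    (hY0 : Integrable Y0 P) (hY1 : Integrable Y1 P)
    (Y : Ω → ℝ) (hY : ∀ ω, Y ω = A ω * Y1 ω + (1 - A ω) * Y0 ω)
    (q : ℝ) (hq : P {ω | R ω = 1} = ENNReal.ofReal q) (hq0 : 0 < q) (hq1 : q < 1)
    -- strong ignorability: A ⫫ (Y(0), Y(1)) ∣ σ(X) under P₁ = P(⬝ ∣ R = 1)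
    (hCI : CondIndepFun (MeasurableSpace.comap X inferInstance) hX.comap_le
      A (fun ω => (Y0 ω, Y1 ω)) (P[|{ω | R ω = 1}]))
    -- exchangeability: R ⫫ Y(0) ∣ σ(X) under P
    (hExch : CondIndepFun (MeasurableSpace.comap X inferInstance) hX.comap_le R Y0 P)
    -- overlap: δ ≤ e₁(X) ≤ 1 − δ and π(X) ≥ δ, P-a.s.
    (δ : ℝ) (hδ : δ ∈ Set.Ioo (0 : ℝ) (1 / 2))
    (e₁ : (Fin p → ℝ) → ℝ)
    (he₁ : IsCondVersion (P[|{ω | R ω = 1}]) X (fun _ => 1) A e₁)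
    (π : (Fin p → ℝ) → ℝ) (hπ : IsCondVersion P X (fun _ => 1) R π)
    (hbd : ∀ᵐ ω ∂P, (δ ≤ e₁ (X ω) ∧ e₁ (X ω) ≤ 1 - δ) ∧ δ ≤ π (X ω))
    -- pooled propensity score and pooled outcome regressions
    (eS : (Fin p → ℝ) → ℝ) (heS : IsCondVersion P X (fun _ => 1) A eS)
    (m₀ m₁ : (Fin p → ℝ) → ℝ)
    (hm₀ : IsCondVersion P X (fun ω => 1 - A ω) Y m₀)
    (hm₁ : IsCondVersion P X A Y m₁)
    -- the ATE in the RCT population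
    (τ : ℝ) (hτ : τ = ∫ ω, (Y1 ω - Y0 ω) ∂(P[|{ω | R ω = 1}])) :
    ∫ ω, (π (X ω) / q * (R ω * A ω * (Y ω - m₁ (X ω)) / eS (X ω)
            - (1 - A ω) * (Y ω - m₀ (X ω)) / (1 - eS (X ω)))
          + R ω / q * (m₁ (X ω) - m₀ (X ω) - τ)) ∂P = 0 := by
  obtain ⟨hδ0, hδ1⟩ := hδ
  set P₁ : Measure Ω := P[|{ω | R ω = 1}] with hP₁
  have hs : MeasurableSet {ω | R ω = 1} := hR (measurableSet_singleton 1)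
  have hac : P₁ ≪ P := cond_absolutelyContinuous
  -- integrals under `P₁`
  have hc : ∀ f : Ω → ℝ, ∫ ω, R ω * f ω ∂P = q * ∫ ω, f ω ∂P₁ := by
    intro f
    have e : (fun ω => R ω * f ω) = Set.indicator {ω | R ω = 1} f := by
      ext ω
      rcases hR01 ω with h | h <;> simp [Set.indicator, h]
    rw [e, integral_indicator hs, hP₁, ProbabilityTheory.cond, integral_smul_measure, hq,
      ENNReal.toReal_inv, ENNReal.toReal_ofReal hq0.le, smul_eq_mul, mul_inv_cancel_left₀ hq0.ne']
  have hi : ∀ f : Ω → ℝ, Integrable f P → Integrable f P₁ := by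
    intro f hf
    rw [hP₁, ProbabilityTheory.cond]
    refine hf.restrict.smul_measure ?_
    rw [hq]
    simp [hq0]
  have hAR' : ∀ᵐ ω ∂P, R ω * A ω = A ω := by
    filter_upwards [hAR] with ω h
    rcases hA01 ω with h1 | h1
    · simp [h1]
    · rcases hR01 ω with h2 | h2
      · rw [h1, h2] at h
        norm_num at h
      · simp [h1, h2]
  have hAb : ∀ᵐ ω ∂P, ‖A ω‖ ≤ 1 := ae_of_all _ fun ω => by
    rcases hA01 ω with h1 | h1 <;> rw [h1] <;> simp
  have hRb : ∀ᵐ ω ∂P, ‖R ω‖ ≤ 1 := ae_of_all _ fun ω => by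
    rcases hR01 ω with h1 | h1 <;> rw [h1] <;> simp
  have h1Ab : ∀ᵐ ω ∂P, ‖1 - A ω‖ ≤ 1 := ae_of_all _ fun ω => by
    rcases hA01 ω with h1 | h1 <;> rw [h1] <;> simp
  have hAi : Integrable A P := Integrable.of_bound hA.aestronglyMeasurable 1 hAb
  have hRi : Integrable R P := Integrable.of_bound hR.aestronglyMeasurable 1 hRb
  have h1Am : Measurable (fun ω => 1 - A ω) := measurable_const.sub hA
  have h1Ai : Integrable (fun ω => 1 - A ω) P :=
    Integrable.of_bound h1Am.aestronglyMeasurable 1 h1Ab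
  have mulA : ∀ f : Ω → ℝ, Integrable f P → Integrable (fun ω => A ω * f ω) P :=
    fun f hf => hf.bdd_mul hA.aestronglyMeasurable hAb
  have mulR : ∀ f : Ω → ℝ, Integrable f P → Integrable (fun ω => R ω * f ω) P :=
    fun f hf => hf.bdd_mul hR.aestronglyMeasurable hRb
  have mul1A : ∀ f : Ω → ℝ, Integrable f P → Integrable (fun ω => (1 - A ω) * f ω) P :=
    fun f hf => hf.bdd_mul h1Am.aestronglyMeasurable h1Ab
  have mulX : ∀ (c : (Fin p → ℝ) → ℝ) (C : ℝ) (f : Ω → ℝ), Measurable c →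
      (∀ᵐ ω ∂P, |c (X ω)| ≤ C) → Integrable f P → Integrable (fun ω => c (X ω) * f ω) P :=
    fun c C f hcm hb hf => hf.bdd_mul (hcm.comp hX).aestronglyMeasurable hb
  have hAY : ∀ ω, A ω * Y ω = A ω * Y1 ω := fun ω => by
    rw [hY]; rcases hA01 ω with h1 | h1 <;> rw [h1] <;> simp
  have h1AY : ∀ ω, (1 - A ω) * Y ω = (1 - A ω) * Y0 ω := fun ω => by
    rw [hY]; rcases hA01 ω with h1 | h1 <;> rw [h1] <;> simp
  have hπm := hπ.1
  have he₁m := he₁.1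
  have heSm := heS.1
  have hm₀m := hm₀.1
  have hm₁m := hm₁.1
  -- `π ≤ 1`
  have hπ1 : ∀ᵐ ω ∂P, π (X ω) ≤ 1 := by
    have h1 : P[R | MeasurableSpace.comap X inferInstance] ≤ᵐ[P]
        P[fun _ => (1 : ℝ) | MeasurableSpace.comap X inferInstance] :=
      condExp_mono hRi (integrable_const 1) (ae_of_all _ fun ω => by
        rcases hR01 ω with h | h <;> simp [h])
    rw [condExp_const hX.comap_le] at h1
    filter_upwards [h1, hπ.ae_eq_condExp hX hRi] with ω h2 h3
    rw [h3]; exact h2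
  -- `eS = π e₁`
  have he₁b : ∀ᵐ ω ∂P, |e₁ (X ω)| ≤ 1 := by
    filter_upwards [hbd] with ω h
    rw [abs_le]; constructor <;> linarith [h.1.1, h.1.2]
  have heS_eq : ∀ᵐ ω ∂P, eS (X ω) = π (X ω) * e₁ (X ω) := by
    have hv : IsCondVersion P X (fun _ => 1) A (fun x => π x * e₁ x) := by
      refine ⟨hπm.mul he₁m, fun h hh ⟨C, hC⟩ => ?_⟩
      have i1 : Integrable (fun ω => e₁ (X ω) * h (X ω)) P :=
        mulX e₁ 1 _ he₁m he₁b
          (Integrable.of_bound (hh.comp hX).aestronglyMeasurable C (ae_of_all _ fun ω => hC _))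
      have k1 := (hπ.pull_out hX hRi (F := fun x => e₁ x * h x) (he₁m.mul hh) (mulR _ i1)).2
      have k2 := he₁.2 h hh ⟨C, hC⟩
      simp only [one_mul] at k2 ⊢
      calc ∫ ω, A ω * h (X ω) ∂P = ∫ ω, R ω * (A ω * h (X ω)) ∂P := by
            refine integral_congr_ae ?_
            filter_upwards [hAR'] with ω h
            rw [← mul_assoc, h]
        _ = ∫ ω, R ω * (e₁ (X ω) * h (X ω)) ∂P := by rw [hc, hc, k2]
        _ = _ := by rw [k1]; simp only [mul_assoc]
    filter_upwards [hv.ae_eq_condExp hX hAi, heS.ae_eq_condExp hX hAi] with ω h1 h2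
    rw [h2, ← h1]
  have hall : ∀ᵐ ω ∂P, δ ≤ e₁ (X ω) ∧ δ ≤ π (X ω) ∧ π (X ω) ≤ 1 ∧ δ * δ ≤ eS (X ω) ∧
      eS (X ω) ≤ 1 - δ := by
    filter_upwards [hbd, hπ1, heS_eq] with ω h1 h2 h3
    obtain ⟨⟨a, b⟩, c⟩ := h1
    refine ⟨a, c, h2, ?_, ?_⟩
    · rw [h3]; exact mul_le_mul c a hδ0.le (hδ0.le.trans c)
    · rw [h3]; nlinarith
  have hdd : 0 < δ * δ := mul_pos hδ0 hδ0
  have hπb : ∀ᵐ ω ∂P, |π (X ω)| ≤ 1 := by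
    filter_upwards [hall] with ω h
    rw [abs_of_nonneg (by linarith [h.2.1])]; exact h.2.2.1
  have heSb : ∀ᵐ ω ∂P, |eS (X ω)| ≤ 1 := by
    filter_upwards [hall] with ω h
    rw [abs_of_nonneg (by linarith [h.2.2.2.1])]; linarith [h.2.2.2.2]
  have he₁ib : ∀ᵐ ω ∂P, |(e₁ (X ω))⁻¹| ≤ δ⁻¹ := by
    filter_upwards [hall] with ω h
    rw [abs_of_nonneg (inv_nonneg.2 (by linarith [h.1]))]
    exact inv_anti₀ hδ0 h.1
  have heSib : ∀ᵐ ω ∂P, |(eS (X ω))⁻¹| ≤ (δ * δ)⁻¹ := by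
    filter_upwards [hall] with ω h
    rw [abs_of_nonneg (inv_nonneg.2 (by linarith [h.2.2.2.1]))]
    exact inv_anti₀ hdd h.2.2.2.1
  have h1eSib : ∀ᵐ ω ∂P, |(1 - eS (X ω))⁻¹| ≤ δ⁻¹ := by
    filter_upwards [hall] with ω h
    rw [abs_of_nonneg (inv_nonneg.2 (by linarith [h.2.2.2.2]))]
    exact inv_anti₀ hδ0 (by linarith [h.2.2.2.2])
  -- integrability of the outcome regressions
  have h1eS := heS.one_sub hX hAi
  have hm₁i : Integrable (fun ω => m₁ (X ω)) P := by
    have i1 : Integrable (fun ω => A ω * m₁ (X ω)) P :=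
      hm₁.integrable_aux hX hA hA01 (by simpa only [hAY] using mulA _ hY1)
    have i2 := mulX (fun x => (eS x)⁻¹) _ _ heSm.inv heSib (heS.pull_out hX hAi hm₁m i1).1
    refine i2.congr ?_
    filter_upwards [hall] with ω h
    have h0 : 0 < eS (X ω) := by linarith [h.2.2.2.1]
    have h1 := h0.ne'
    field_simp
  have hm₀i : Integrable (fun ω => m₀ (X ω)) P := by
    have i1 : Integrable (fun ω => (1 - A ω) * m₀ (X ω)) P :=
      hm₀.integrable_aux hX h1Am (fun ω => by rcases hA01 ω with h | h <;> simp [h])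
        (by simpa only [h1AY] using mul1A _ hY0)
    have i2 := mulX (fun x => (1 - eS x)⁻¹) _ _ (measurable_const.sub heSm).inv h1eSib
      (h1eS.pull_out hX h1Ai hm₀m i1).1
    refine i2.congr ?_
    filter_upwards [hall] with ω h
    have h0 : 0 < 1 - eS (X ω) := by linarith [h.2.2.2.2]
    have h0' := h0.ne'
    field_simp
  -- the treated arm
  have M1 : ∫ ω, m₁ (X ω) ∂P₁ = ∫ ω, Y1 ω ∂P₁ := by
    have k1 := (he₁.pull_out_indep hX hA (hY0m.prodMk hY1m) (hi _ hAi) hCI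
      (F := fun z => (e₁ z.1)⁻¹ * z.2.2) (by fun_prop)
      (hi _ (mulA _ (mulX _ _ _ he₁m.inv he₁ib hY1)))).2
    have k2 := (he₁.pull_out hX (hi _ hAi) (F := fun x => (e₁ x)⁻¹ * m₁ x) (by fun_prop)
      (hi _ (mulA _ (mulX _ _ _ he₁m.inv he₁ib hm₁i)))).2
    have k3 := hm₁.eq_of_ae_bdd (h := fun x => (e₁ x)⁻¹) he₁m.inv he₁ib
    have k4 : ∀ f : Ω → ℝ, ∫ ω, e₁ (X ω) * ((e₁ (X ω))⁻¹ * f ω) ∂P₁ = ∫ ω, f ω ∂P₁ := by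
      intro f
      refine integral_congr_ae (hac.ae_le ?_)
      filter_upwards [hall] with ω h
      have h0 : 0 < e₁ (X ω) := by linarith [h.1]
      exact mul_inv_cancel_left₀ h0.ne' _
    have k5 : ∀ f : Ω → ℝ, ∫ ω, A ω * f ω * (e₁ (X ω))⁻¹ ∂P
        = q * ∫ ω, A ω * ((e₁ (X ω))⁻¹ * f ω) ∂P₁ := by
      intro f
      rw [← hc]
      refine integral_congr_ae ?_
      filter_upwards [hAR'] with ω h
      rw [← mul_assoc, h]; ring
    rw [k4] at k1 k2
    simp only [hAY] at k3
    rw [k5, k5, k1, k2] at k3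
    exact (mul_left_cancel₀ hq0.ne' k3).symm
  -- the control arm
  have M0 : ∫ ω, m₀ (X ω) ∂P₁ = ∫ ω, Y0 ω ∂P₁ := by
    let g : (Fin p → ℝ) → ℝ := fun x => π x * (1 - eS x)⁻¹
    have hgm : Measurable g := hπm.mul (measurable_const.sub heSm).inv
    have hgb : ∀ᵐ ω ∂P, |g (X ω)| ≤ 1 * δ⁻¹ := by
      filter_upwards [hπb, h1eSib] with ω h1 h2
      simp only [g, abs_mul]
      gcongr
    have hg1 : ∀ᵐ ω ∂P, (1 - eS (X ω)) * g (X ω) = π (X ω) := by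
      filter_upwards [hall] with ω h
      have h0 : 0 < 1 - eS (X ω) := by linarith [h.2.2.2.2]
      have h0' := h0.ne'
      simp only [g]
      field_simp
    have igm := mulX g _ _ hgm hgb hm₀i
    have igY := mulX g _ _ hgm hgb hY0
    have ieY := mulX e₁ _ _ he₁m he₁b igY
    have isY := mulX eS _ _ heSm heSb igY
    have k1 := (hπ.pull_out hX hRi hm₀m (mulR _ hm₀i)).2
    have k2 := (h1eS.pull_out hX h1Ai (F := fun x => g x * m₀ x) (hgm.mul hm₀m)
      (mul1A _ igm)).2
    have k3 := hm₀.eq_of_ae_bdd hgm hgb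
    have k4 := (he₁.pull_out_indep hX hA (hY0m.prodMk hY1m) (hi _ hAi) hCI
      (F := fun z => g z.1 * z.2.1) (by fun_prop) (hi _ (mulA _ igY))).2
    have k5 := (hπ.pull_out_indep hX hR hY0m hRi hExch
      (F := fun z => e₁ z.1 * (g z.1 * z.2)) (by fun_prop) (mulR _ ieY)).2
    have k6 := (hπ.pull_out_indep hX hR hY0m hRi hExch
      (F := fun z => z.2) (by fun_prop) (mulR _ hY0)).2
    dsimp only at k2 k4 k5 k6
    have k7 : ∫ ω, A ω * (g (X ω) * Y0 ω) ∂P = ∫ ω, eS (X ω) * (g (X ω) * Y0 ω) ∂P := by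
      calc _ = ∫ ω, R ω * (A ω * (g (X ω) * Y0 ω)) ∂P := by
            refine integral_congr_ae ?_
            filter_upwards [hAR'] with ω h
            rw [← mul_assoc (R ω), h]
        _ = ∫ ω, R ω * (e₁ (X ω) * (g (X ω) * Y0 ω)) ∂P := by rw [hc, hc, k4]
        _ = _ := by
            rw [k5]
            refine integral_congr_ae ?_
            filter_upwards [heS_eq] with ω h
            rw [h]; ring
    have k8 : ∫ ω, R ω * m₀ (X ω) ∂P = ∫ ω, R ω * Y0 ω ∂P := by
      calc ∫ ω, R ω * m₀ (X ω) ∂P = ∫ ω, π (X ω) * m₀ (X ω) ∂P := k1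
        _ = ∫ ω, (1 - eS (X ω)) * (g (X ω) * m₀ (X ω)) ∂P := by
            refine integral_congr_ae ?_
            filter_upwards [hg1] with ω h
            rw [← mul_assoc, h]
        _ = ∫ ω, (1 - A ω) * m₀ (X ω) * g (X ω) ∂P := by
            rw [← k2]; congr 1; ext ω; ring
        _ = ∫ ω, (1 - A ω) * Y0 ω * g (X ω) ∂P := by
            rw [← k3]; simp only [h1AY]
        _ = ∫ ω, (g (X ω) * Y0 ω - A ω * (g (X ω) * Y0 ω)) ∂P := by
            congr 1; ext ω; ring
        _ = ∫ ω, (g (X ω) * Y0 ω - eS (X ω) * (g (X ω) * Y0 ω)) ∂P := by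
            rw [integral_sub igY (mulA _ igY), integral_sub igY isY, k7]
        _ = ∫ ω, π (X ω) * Y0 ω ∂P := by
            refine integral_congr_ae ?_
            filter_upwards [hg1] with ω h
            rw [← h]; ring
        _ = _ := k6.symm
    rw [hc, hc] at k8
    exact mul_left_cancel₀ hq0.ne' k8
  -- assembling
  let h₁ : (Fin p → ℝ) → ℝ := fun x => q⁻¹ * (π x * (eS x)⁻¹)
  let h₀ : (Fin p → ℝ) → ℝ := fun x => q⁻¹ * (π x * (1 - eS x)⁻¹)
  have h₁m : Measurable h₁ := measurable_const.mul (hπm.mul heSm.inv)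
  have h₀m : Measurable h₀ := measurable_const.mul (hπm.mul (measurable_const.sub heSm).inv)
  have h₁b : ∀ᵐ ω ∂P, |h₁ (X ω)| ≤ |q⁻¹| * (1 * (δ * δ)⁻¹) := by
    filter_upwards [hπb, heSib] with ω a b
    simp only [h₁, abs_mul]
    gcongr
  have h₀b : ∀ᵐ ω ∂P, |h₀ (X ω)| ≤ |q⁻¹| * (1 * δ⁻¹) := by
    filter_upwards [hπb, h1eSib] with ω a b
    simp only [h₀, abs_mul]
    gcongr
  have z1 := hm₁.eq_of_ae_bdd h₁m h₁b
  have z0 := hm₀.eq_of_ae_bdd h₀m h₀b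
  simp only [hAY] at z1
  simp only [h1AY] at z0
  have h₁X := (h₁m.comp hX).aestronglyMeasurable (μ := P)
  have h₀X := (h₀m.comp hX).aestronglyMeasurable (μ := P)
  have j1 : Integrable (fun ω => A ω * Y1 ω * h₁ (X ω)) P := (mulA _ hY1).mul_bdd h₁X h₁b
  have j2 : Integrable (fun ω => A ω * m₁ (X ω) * h₁ (X ω)) P := (mulA _ hm₁i).mul_bdd h₁X h₁b
  have j3 : Integrable (fun ω => (1 - A ω) * Y0 ω * h₀ (X ω)) P :=
    (mul1A _ hY0).mul_bdd h₀X h₀b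
  have j4 : Integrable (fun ω => (1 - A ω) * m₀ (X ω) * h₀ (X ω)) P :=
    (mul1A _ hm₀i).mul_bdd h₀X h₀b
  have j5 : Integrable (fun ω => m₁ (X ω) - m₀ (X ω) - τ) P :=
    (hm₁i.sub hm₀i).sub (integrable_const τ)
  have j6 : Integrable (fun ω => q⁻¹ * (R ω * (m₁ (X ω) - m₀ (X ω) - τ))) P :=
    (mulR _ j5).const_mul _
  have hprob : IsProbabilityMeasure P₁ := cond_isProbabilityMeasure (by rw [hq]; simp [hq0])
  have t3 : ∫ ω, (m₁ (X ω) - m₀ (X ω) - τ) ∂P₁ = 0 := by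
    have a1 : Integrable (fun ω => m₁ (X ω) - m₀ (X ω)) P₁ := hi _ (hm₁i.sub hm₀i)
    rw [integral_sub a1 (integrable_const τ),
      integral_sub (hi _ hm₁i) (hi _ hm₀i), M1, M0, hτ, integral_sub (hi _ hY1) (hi _ hY0)]
    simp
  calc _ = ∫ ω, ((A ω * Y1 ω * h₁ (X ω) - A ω * m₁ (X ω) * h₁ (X ω))
        - ((1 - A ω) * Y0 ω * h₀ (X ω) - (1 - A ω) * m₀ (X ω) * h₀ (X ω))
        + q⁻¹ * (R ω * (m₁ (X ω) - m₀ (X ω) - τ))) ∂P := by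
        refine integral_congr_ae ?_
        filter_upwards [hAR'] with ω h
        rw [h, ← hAY, ← h1AY]
        simp only [h₁, h₀, div_eq_mul_inv]
        ring
    _ = 0 := by
        have j12 : Integrable (fun ω => A ω * Y1 ω * h₁ (X ω) - A ω * m₁ (X ω) * h₁ (X ω)) P :=
          j1.sub j2
        have j34 : Integrable (fun ω => (1 - A ω) * Y0 ω * h₀ (X ω)
            - (1 - A ω) * m₀ (X ω) * h₀ (X ω)) P := j3.sub j4
        have j14 : Integrable (fun ω => (A ω * Y1 ω * h₁ (X ω) - A ω * m₁ (X ω) * h₁ (X ω))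
            - ((1 - A ω) * Y0 ω * h₀ (X ω) - (1 - A ω) * m₀ (X ω) * h₀ (X ω))) P := j12.sub j34
        rw [integral_add j14 j6, integral_sub j12 j34, integral_sub j1 j2, integral_sub j3 j4,
          z1, z0, integral_const_mul, hc, t3]
        simp
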